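/- arXiv:1809.04039 — 4 statements merged into one kernel-verified Lean document; each statement's English description precedes it below -/
import Mathlib

section
/- Let p > 0, q > 0, set μ = (1/π)√(q/p), let m ≥ 1 be an integer, let v̄₁,…,v̄_m ∈ ℝ and A ∈ ℝ, and define w(x) = A sinh(μπx) + √2 Σ_{n=1}^m (v̄_n/(p n² π² + q)) sin(nπx) for x ∈ [0,1]. Then ∫₀¹ w(x)² dx ≥ Σ_{n=1}^m v̄_n²/(p n² π² + q)² − (8μπ sinh²(μπ)/(sinh(2μπ) − 2μπ)) (Σ_{n=1}^m (−1)ⁿ n π p v̄_n/(p n² π² + q)²)². -/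
open MeasureTheory Real

lemma integral_sinh_mul_sq {a : ℝ} (ha : a ≠ 0) :
    ∫ x in (0:ℝ)..1, sinh (a * x) ^ 2 = (sinh (2 * a) - 2 * a) / (4 * a) := by
  have hd : ∀ x ∈ Set.uIcc (0:ℝ) 1,
      HasDerivAt (fun x => sinh (a * x) * cosh (a * x) / (2 * a) - x / 2) (sinh (a * x) ^ 2) x := by
    intro x _
    have h := ((hasDerivAt_id' x).const_mul a)
    refine (((h.sinh.mul h.cosh).div_const (2 * a)).sub ((hasDerivAt_id' x).div_const 2)).congr_deriv ?_
    simp only [mul_one]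
    field_simp
    linear_combination cosh_sq (a * x)
  rw [intervalIntegral.integral_eq_sub_of_hasDerivAt hd
    (Continuous.intervalIntegrable (by fun_prop) _ _)]
  simp only [mul_one, mul_zero, sinh_zero, sinh_two_mul]
  field_simp
  ring

lemma integral_sinh_mul_mul_sin_nat_mul_pi {a : ℝ} (ha : a ≠ 0) (n : ℕ) :
    ∫ x in (0:ℝ)..1, sinh (a * x) * sin (n * π * x) =
      -((-1) ^ n * (n * π) * sinh a / (a ^ 2 + (n * π) ^ 2)) := by
  have hne : a ^ 2 + (n * π) ^ 2 ≠ 0 := by positivity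
  have hd : ∀ x ∈ Set.uIcc (0:ℝ) 1,
      HasDerivAt (fun x => (a * (cosh (a * x) * sin (n * π * x))
        - n * π * (sinh (a * x) * cos (n * π * x))) / (a ^ 2 + (n * π) ^ 2))
        (sinh (a * x) * sin (n * π * x)) x := by
    intro x _
    have h := ((hasDerivAt_id' x).const_mul a)
    have h' := ((hasDerivAt_id' x).const_mul (n * π))
    refine ((((h.cosh.mul h'.sin).const_mul a).sub
      ((h.sinh.mul h'.cos).const_mul (n * π))).div_const (a ^ 2 + (n * π) ^ 2)).congr_deriv ?_
    simp only [mul_one]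
    field_simp
    ring
  rw [intervalIntegral.integral_eq_sub_of_hasDerivAt hd
    (Continuous.intervalIntegrable (by fun_prop) _ _)]
  simp only [mul_one, mul_zero, sinh_zero, sin_zero, sin_nat_mul_pi, cos_nat_mul_pi]
  ring

lemma integral_sin_nat_mul_pi_sq {n : ℕ} (hn : n ≠ 0) :
    ∫ x in (0:ℝ)..1, sin (n * π * x) * sin (n * π * x) = 1 / 2 := by
  have hn' : (n : ℝ) ≠ 0 := by exact_mod_cast hn
  have hd : ∀ x ∈ Set.uIcc (0:ℝ) 1,
      HasDerivAt (fun x => x / 2 - sin (n * π * x) * cos (n * π * x) / (2 * (n * π)))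
        (sin (n * π * x) * sin (n * π * x)) x := by
    intro x _
    have h := ((hasDerivAt_id' x).const_mul (n * π))
    refine (((hasDerivAt_id' x).div_const 2).sub
      ((h.sin.mul h.cos).div_const (2 * (n * π)))).congr_deriv ?_
    simp only [mul_one]
    field_simp
    linear_combination -sin_sq_add_cos_sq (n * π * x)
  rw [intervalIntegral.integral_eq_sub_of_hasDerivAt hd
    (Continuous.intervalIntegrable (by fun_prop) _ _)]
  simp [sin_nat_mul_pi]

lemma integral_sin_nat_mul_pi_mul_sin_of_ne {n k : ℕ} (hnk : n ≠ k) :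
    ∫ x in (0:ℝ)..1, sin (n * π * x) * sin (k * π * x) = 0 := by
  have h1 : (n : ℝ) - k ≠ 0 := sub_ne_zero.2 (by exact_mod_cast hnk)
  have h2 : (n : ℝ) + k ≠ 0 := by
    have : n + k ≠ 0 := by omega
    exact_mod_cast this
  have h3 : ((n * π) ^ 2 - (k * π) ^ 2 : ℝ) ≠ 0 := by
    have : ((n * π) ^ 2 - (k * π) ^ 2 : ℝ) = (n - k) * (n + k) * π ^ 2 := by ring
    rw [this]
    positivity
  have hd : ∀ x ∈ Set.uIcc (0:ℝ) 1,
      HasDerivAt (fun x => (k * π * (sin (n * π * x) * cos (k * π * x))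
        - n * π * (cos (n * π * x) * sin (k * π * x))) / ((n * π) ^ 2 - (k * π) ^ 2))
        (sin (n * π * x) * sin (k * π * x)) x := by
    intro x _
    have h := ((hasDerivAt_id' x).const_mul (n * π))
    have h' := ((hasDerivAt_id' x).const_mul (k * π))
    refine ((((h.sin.mul h'.cos).const_mul (k * π)).sub
      ((h.cos.mul h'.sin).const_mul (n * π))).div_const ((n * π) ^ 2 - (k * π) ^ 2)).congr_deriv ?_
    simp only [mul_one]
    rw [div_eq_iff h3]
    ring
  rw [intervalIntegral.integral_eq_sub_of_hasDerivAt hd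
    (Continuous.intervalIntegrable (by fun_prop) _ _)]
  simp [sin_nat_mul_pi]

lemma integral_sum_sin_nat_mul_pi_sq (m : ℕ) (c : ℕ → ℝ) :
    ∫ x in (0:ℝ)..1, (∑ n ∈ Finset.Icc 1 m, c n * sin (n * π * x)) ^ 2 =
      (∑ n ∈ Finset.Icc 1 m, c n ^ 2) / 2 := by
  simp_rw [sq, Finset.sum_mul_sum]
  rw [intervalIntegral.integral_finsetSum
    fun _ _ => Continuous.intervalIntegrable (by fun_prop) _ _, Finset.sum_div]
  refine Finset.sum_congr rfl fun n hn => ?_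
  rw [intervalIntegral.integral_finsetSum
    fun _ _ => Continuous.intervalIntegrable (by fun_prop) _ _, Finset.sum_eq_single_of_mem n hn]
  · simp_rw [mul_mul_mul_comm (c n)]
    rw [intervalIntegral.integral_const_mul,
      integral_sin_nat_mul_pi_sq (by have := (Finset.mem_Icc.1 hn).1; omega)]
    ring
  · intro k _ hk
    simp_rw [mul_mul_mul_comm (c n)]
    rw [intervalIntegral.integral_const_mul, integral_sin_nat_mul_pi_mul_sin_of_ne hk.symm,
      mul_zero]

lemma integral_sinh_mul_mul_sum_sin {a : ℝ} (ha : a ≠ 0) (m : ℕ) (c : ℕ → ℝ) :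
    ∫ x in (0:ℝ)..1, sinh (a * x) * ∑ n ∈ Finset.Icc 1 m, c n * sin (n * π * x) =
      -(sinh a * ∑ n ∈ Finset.Icc 1 m, c n * ((-1) ^ n * (n * π) / (a ^ 2 + (n * π) ^ 2))) := by
  simp_rw [Finset.mul_sum, mul_left_comm (sinh _)]
  rw [intervalIntegral.integral_finsetSum
    fun _ _ => Continuous.intervalIntegrable (by fun_prop) _ _, ← Finset.sum_neg_distrib]
  refine Finset.sum_congr rfl fun n _ => ?_
  rw [intervalIntegral.integral_const_mul, integral_sinh_mul_mul_sin_nat_mul_pi ha]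
  ring

/-- Inequality (5.10): lower bound on `∫₀¹ w²` for
`w(x) = A sinh(μπx) + √2 Σ_{n=1}^m (v̄_n/(p n² π² + q)) sin(nπx)`, `μ = (1/π)√(q/p)`. -/
theorem stmt12 (p q μ : ℝ) (hp : 0 < p) (hq : 0 < q)
    (hμ : μ = (1 / π) * Real.sqrt (q / p))
    (m : ℕ) (hm : 1 ≤ m) (vb : ℕ → ℝ) (A : ℝ) :
    (∫ x in (0:ℝ)..1,
        (A * Real.sinh (μ * π * x) + Real.sqrt 2 * ∑ n ∈ Finset.Icc 1 m,
          vb n / (p * (n : ℝ) ^ 2 * π ^ 2 + q) * Real.sin ((n : ℝ) * π * x)) ^ 2) ≥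
      (∑ n ∈ Finset.Icc 1 m, (vb n) ^ 2 / (p * (n : ℝ) ^ 2 * π ^ 2 + q) ^ 2) -
        (8 * μ * π * Real.sinh (μ * π) ^ 2 / (Real.sinh (2 * μ * π) - 2 * μ * π)) *
          (∑ n ∈ Finset.Icc 1 m,
            (-1 : ℝ) ^ n * (n : ℝ) * π * p * vb n / (p * (n : ℝ) ^ 2 * π ^ 2 + q) ^ 2) ^ 2 := by
  have ha : 0 < μ * π := by rw [hμ]; positivity
  have hasq : p * (μ * π) ^ 2 = q := by
    have : μ * π = √(q / p) := by rw [hμ]; field_simp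
    rw [this, Real.sq_sqrt (by positivity)]
    field_simp
  have hexp : 8 * μ * π = 8 * (μ * π) := by ring
  have hexp' : 2 * μ * π = 2 * (μ * π) := by ring
  rw [hexp, hexp']
  set a := μ * π with ha_def
  set T := ∑ n ∈ Finset.Icc 1 m,
    (-1 : ℝ) ^ n * (n : ℝ) * π * p * vb n / (p * (n : ℝ) ^ 2 * π ^ 2 + q) ^ 2 with hT
  have hS : 0 < sinh (2 * a) - 2 * a := sub_pos.2 (self_lt_sinh_iff.2 (by positivity))
  have hsum : ∑ n ∈ Finset.Icc 1 m, vb n / (p * (n : ℝ) ^ 2 * π ^ 2 + q) *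
      ((-1) ^ n * (n * π) / (a ^ 2 + (n * π) ^ 2)) = T := by
    refine Finset.sum_congr rfl fun n _ => ?_
    have h0 : p * (n : ℝ) ^ 2 * π ^ 2 + q ≠ 0 := by positivity
    have h1 : a ^ 2 + (n * π) ^ 2 = (p * (n : ℝ) ^ 2 * π ^ 2 + q) / p := by
      rw [← hasq]
      field_simp
      ring
    rw [h1]
    field_simp
  have hint : (∫ x in (0:ℝ)..1, (A * sinh (a * x) + √2 * ∑ n ∈ Finset.Icc 1 m,
      vb n / (p * (n : ℝ) ^ 2 * π ^ 2 + q) * sin (n * π * x)) ^ 2) =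
      A ^ 2 * ((sinh (2 * a) - 2 * a) / (4 * a)) + 2 * √2 * A * -(sinh a * T) +
        ∑ n ∈ Finset.Icc 1 m, vb n ^ 2 / (p * (n : ℝ) ^ 2 * π ^ 2 + q) ^ 2 := by
    have hsq : ∀ x : ℝ, (A * sinh (a * x) + √2 * ∑ n ∈ Finset.Icc 1 m,
        vb n / (p * (n : ℝ) ^ 2 * π ^ 2 + q) * sin (n * π * x)) ^ 2 =
        A ^ 2 * sinh (a * x) ^ 2 + 2 * √2 * A * (sinh (a * x) * ∑ n ∈ Finset.Icc 1 m,
          vb n / (p * (n : ℝ) ^ 2 * π ^ 2 + q) * sin (n * π * x)) +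
        2 * (∑ n ∈ Finset.Icc 1 m,
          vb n / (p * (n : ℝ) ^ 2 * π ^ 2 + q) * sin (n * π * x)) ^ 2 := by
      intro x
      rw [add_sq, mul_pow, mul_pow, Real.sq_sqrt (by norm_num)]
      ring
    simp_rw [hsq]
    rw [intervalIntegral.integral_add (Continuous.intervalIntegrable (by fun_prop) _ _)
        (Continuous.intervalIntegrable (by fun_prop) _ _),
      intervalIntegral.integral_add (Continuous.intervalIntegrable (by fun_prop) _ _)
        (Continuous.intervalIntegrable (by fun_prop) _ _),
      intervalIntegral.integral_const_mul, intervalIntegral.integral_const_mul,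
      intervalIntegral.integral_const_mul, integral_sinh_mul_sq ha.ne',
      integral_sinh_mul_mul_sum_sin ha.ne', hsum,
      integral_sum_sin_nat_mul_pi_sq, mul_div_cancel₀ _ two_ne_zero]
    simp_rw [div_pow]
  rw [hint, ge_iff_le, ← sub_nonneg]
  set S := sinh (2 * a) - 2 * a
  clear_value a S
  have h2 : √2 ^ 2 = 2 := Real.sq_sqrt (by norm_num)
  have hcomplete : A ^ 2 * (S / (4 * a)) + 2 * √2 * A * -(sinh a * T) +
      8 * a * sinh a ^ 2 / S * T ^ 2 = (A * S - √2 * (4 * a) * (sinh a * T)) ^ 2 / (4 * a * S) := by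
    field_simp
    linear_combination (-16 * a ^ 2 * sinh a ^ 2 * T ^ 2) * h2
  have hnonneg : 0 ≤ (A * S - √2 * (4 * a) * (sinh a * T)) ^ 2 / (4 * a * S) := by positivity
  linarith
end

section
/- Let a > 0 and 0 < b < a. Let c ∈ C⁰(ℝ₊) ∩ C¹((0,+∞)) and let v : ℝ₊ → ℝ be continuous, and suppose c'(t) = −a c(t) + v(t) for all t > 0. Then for all t ≥ 0: |c(t)| ≤ |c(0)| exp(−a t) + (1/(2(a − b)))^{1/2} (∫₀ᵗ exp(−2b(t−s)) v(s)² ds)^{1/2}. -/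
open MeasureTheory Real

/-- Cauchy–Schwarz inequality for interval integrals of real functions. -/
theorem sq_intervalIntegral_mul_le {f g : ℝ → ℝ} {x y : ℝ} (hxy : x ≤ y)
    (hff : IntervalIntegrable (fun s => f s ^ 2) volume x y)
    (hgg : IntervalIntegrable (fun s => g s ^ 2) volume x y)
    (hfg : IntervalIntegrable (fun s => f s * g s) volume x y) :
    (∫ s in x..y, f s * g s) ^ 2 ≤ (∫ s in x..y, f s ^ 2) * ∫ s in x..y, g s ^ 2 := by
  have key : ∀ r : ℝ, 0 ≤ (∫ s in x..y, f s ^ 2) * (r * r) +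
      (2 * ∫ s in x..y, f s * g s) * r + ∫ s in x..y, g s ^ 2 := by
    intro r
    have h : ∫ s in x..y, (r * f s + g s) ^ 2 = (∫ s in x..y, f s ^ 2) * (r * r) +
        (2 * ∫ s in x..y, f s * g s) * r + ∫ s in x..y, g s ^ 2 := by
      calc ∫ s in x..y, (r * f s + g s) ^ 2
          = ∫ s in x..y, ((r * r) * f s ^ 2 + (2 * r) * (f s * g s) + g s ^ 2) := by
            congr 1; ext s; ring
        _ = _ := by
            rw [intervalIntegral.integral_add ((hff.const_mul _).add (hfg.const_mul _)) hgg,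
              intervalIntegral.integral_add (hff.const_mul _) (hfg.const_mul _),
              intervalIntegral.integral_const_mul, intervalIntegral.integral_const_mul]
            ring
    rw [← h]
    exact intervalIntegral.integral_nonneg hxy fun s _ => sq_nonneg _
  have := discrim_le_zero key
  rw [discrim] at this
  linarith

/-- Variation of constants formula for `c' = -a c + v`. -/
theorem eq_exp_mul_add_integral_of_hasDerivAt {a t : ℝ} {c v : ℝ → ℝ} (ht : 0 ≤ t)
    (hc : ContinuousOn c (Set.Icc 0 t)) (hv : ContinuousOn v (Set.Icc 0 t))
    (hode : ∀ s ∈ Set.Ioo 0 t, HasDerivAt c (-a * c s + v s) s) :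
    c t = exp (-a * t) * c 0 + ∫ s in (0 : ℝ)..t, exp (-a * (t - s)) * v s := by
  have h := intervalIntegral.integral_eq_sub_of_hasDerivAt_of_le
    (f := fun s => exp (-a * (t - s)) * c s) (f' := fun s => exp (-a * (t - s)) * v s) ht
    (by fun_prop) (fun s hs => by
      have he : HasDerivAt (fun s => exp (-a * (t - s))) (exp (-a * (t - s)) * (-a * -1)) s :=
        (((hasDerivAt_id s).const_sub t).const_mul (-a)).exp
      exact (he.mul (hode s hs)).congr_deriv (by ring))
    (ContinuousOn.intervalIntegrable_of_Icc ht (by fun_prop))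
  rw [h]
  simp

/-- The weight `exp (-k (t - s))` has integral at most `1 / k` over `[0, t]`. -/
theorem integral_exp_neg_mul_sub_le {k : ℝ} (hk : 0 < k) (t : ℝ) :
    ∫ s in (0 : ℝ)..t, exp (-k * (t - s)) ≤ 1 / k := by
  have h := intervalIntegral.integral_eq_sub_of_hasDerivAt (a := 0) (b := t)
    (f := fun s => exp (-k * (t - s)) / k) (f' := fun s => exp (-k * (t - s)))
    (fun s _ => by
      have he : HasDerivAt (fun s => exp (-k * (t - s))) (exp (-k * (t - s)) * (-k * -1)) s :=
        (((hasDerivAt_id s).const_sub t).const_mul (-k)).exp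
      exact (he.div_const k).congr_deriv (by field_simp))
    (Continuous.intervalIntegrable (by fun_prop) _ _)
  rw [h]
  have : 0 < exp (-k * (t - 0)) / k := by positivity
  simp only [sub_self, mul_zero, exp_zero]
  linarith

/-- Estimate (5.25)-type bound for a scalar linear ODE `c' = -a c + v`. -/
theorem stmt13 (a b : ℝ) (ha : 0 < a) (hb0 : 0 < b) (hba : b < a)
    (c v : ℝ → ℝ)
    (hc : ContinuousOn c (Set.Ici (0:ℝ)))
    (hv : ContinuousOn v (Set.Ici (0:ℝ)))
    (hode : ∀ t > (0:ℝ), HasDerivAt c (-a * c t + v t) t) :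
    ∀ t ≥ (0:ℝ), |c t| ≤ |c 0| * Real.exp (-a * t) +
      Real.sqrt (1 / (2 * (a - b))) *
        Real.sqrt (∫ s in (0:ℝ)..t, Real.exp (-2 * b * (t - s)) * (v s) ^ 2) := by
  intro t ht
  have hv' : ContinuousOn v (Set.Icc 0 t) := hv.mono Set.Icc_subset_Ici_self
  have hk : 0 < 2 * (a - b) := by linarith
  have hcs := sq_intervalIntegral_mul_le (f := fun s => exp (-(a - b) * (t - s)))
    (g := fun s => exp (-b * (t - s)) * v s) ht
    (ContinuousOn.intervalIntegrable_of_Icc ht (by fun_prop))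
    (ContinuousOn.intervalIntegrable_of_Icc ht (by fun_prop))
    (ContinuousOn.intervalIntegrable_of_Icc ht (by fun_prop))
  have hfg : ∀ s, exp (-(a - b) * (t - s)) * (exp (-b * (t - s)) * v s) =
      exp (-a * (t - s)) * v s := fun s => by
    rw [← mul_assoc, ← exp_add]; ring_nf
  have hff : ∀ s, exp (-(a - b) * (t - s)) ^ 2 = exp (-(2 * (a - b)) * (t - s)) := fun s => by
    rw [← exp_nat_mul]; push_cast; ring_nf
  have hgg : ∀ s, (exp (-b * (t - s)) * v s) ^ 2 = exp (-2 * b * (t - s)) * v s ^ 2 := fun s => by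
    rw [mul_pow, ← exp_nat_mul]; push_cast; ring_nf
  simp only [hfg, hff, hgg] at hcs
  have hnonneg : 0 ≤ ∫ s in (0:ℝ)..t, exp (-2 * b * (t - s)) * v s ^ 2 :=
    intervalIntegral.integral_nonneg ht fun s _ => by positivity
  rw [eq_exp_mul_add_integral_of_hasDerivAt ht (hc.mono Set.Icc_subset_Ici_self) hv'
    fun s hs => hode s hs.1]
  refine (abs_add_le _ _).trans (add_le_add ?_ ?_)
  · rw [abs_mul, abs_exp, mul_comm]
  · rw [← sqrt_mul (by positivity)]
    exact abs_le_sqrt (hcs.trans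
      (mul_le_mul_of_nonneg_right (integral_exp_neg_mul_sub_le hk t) hnonneg))
end

section
/- Let ω > 0 and 0 < δ < ω². Let ξ ∈ C⁰(ℝ₊) ∩ C¹((0,+∞)), let K : ℝ₊ → ℝ be continuous, and let g : ℝ₊ → ℝ₊ be continuous, and suppose ξ'(t) = −ω² ξ(t) + K(t) for all t > 0 and |K(t)| ≤ g(t) for all t ≥ 0. Then for all t ≥ 0: |ξ(t)| ≤ exp(−ω² t)|ξ(0)| + (1/(ω² − δ)) sup_{0≤s≤t}( g(s) exp(−δ(t−s)) ). -/
open Real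

/-- On a compact set, a nonnegative continuous function is bounded by its iterated supremum. -/
theorem le_biSup_of_continuousOn_of_nonneg {f : ℝ → ℝ} {S : Set ℝ} (hS : IsCompact S)
    (hf : ContinuousOn f S) (hnn : ∀ x ∈ S, 0 ≤ f x) {x : ℝ} (hx : x ∈ S) :
    f x ≤ ⨆ s ∈ S, f s := by
  obtain ⟨C, hC⟩ := hS.bddAbove_image hf
  have hbdd : BddAbove (Set.range fun s => ⨆ _ : s ∈ S, f s) := by
    refine ⟨C, ?_⟩
    rintro _ ⟨s, rfl⟩
    by_cases hs : s ∈ S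
    · simpa [hs] using hC (Set.mem_image_of_mem f hs)
    · simpa [hs] using (hnn x hx).trans (hC (Set.mem_image_of_mem f hx))
  have h := le_ciSup hbdd x
  simpa [hx] using h

/-- One-sided Grönwall-type bound for `y' = -a y + k` when `k` is dominated by a decaying
exponential. -/
theorem le_of_hasDerivAt_of_le_exp {a δ M t : ℝ} (hδ : δ < a) (hM : 0 ≤ M) (ht : 0 ≤ t)
    {y k : ℝ → ℝ} (hy : ContinuousOn y (Set.Ici 0))
    (hode : ∀ s > 0, HasDerivAt y (-a * y s + k s) s)
    (hk : ∀ s ∈ Set.Icc 0 t, k s ≤ M * exp (δ * (t - s))) :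
    y t ≤ exp (-a * t) * y 0 + 1 / (a - δ) * M := by
  have had : 0 < a - δ := sub_pos.2 hδ
  let h : ℝ → ℝ := fun s => M / (a - δ) * exp (δ * t + (a - δ) * s) - exp (a * s) * y s
  have hderiv : ∀ s > 0, HasDerivAt h
      (exp (a * s) * (M * exp (δ * (t - s)) - k s)) s := by
    intro s hs
    have h1 : HasDerivAt (fun s : ℝ => exp (δ * t + (a - δ) * s))
        (exp (δ * t + (a - δ) * s) * ((a - δ) * 1)) s :=
      (((hasDerivAt_id s).const_mul (a - δ)).const_add (δ * t)).exp
    have h2 : HasDerivAt (fun s : ℝ => exp (a * s)) (exp (a * s) * (a * 1)) s :=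
      ((hasDerivAt_id s).const_mul a).exp
    refine ((h1.const_mul (M / (a - δ))).sub (h2.mul (hode s hs))).congr_deriv ?_
    have he : exp (δ * t + (a - δ) * s) = exp (a * s) * exp (δ * (t - s)) := by
      rw [← exp_add]; ring_nf
    rw [he]
    field_simp
    ring
  have hmono : MonotoneOn h (Set.Icc 0 t) := by
    refine monotoneOn_of_deriv_nonneg (convex_Icc 0 t) ?_ ?_ ?_
    · have hy' : ContinuousOn y (Set.Icc 0 t) := hy.mono Set.Icc_subset_Ici_self
      fun_prop
    · intro s hs
      rw [interior_Icc] at hs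
      exact (hderiv s hs.1).differentiableAt.differentiableWithinAt
    · intro s hs
      rw [interior_Icc] at hs
      rw [(hderiv s hs.1).deriv]
      exact mul_nonneg (exp_pos _).le (sub_nonneg.2 (hk s ⟨hs.1.le, hs.2.le⟩))
  have hle := hmono (Set.left_mem_Icc.2 ht) (Set.right_mem_Icc.2 ht) ht
  have h0 : 0 ≤ M / (a - δ) * exp (δ * t + (a - δ) * 0) := by positivity
  have het : δ * t + (a - δ) * t = a * t := by ring
  simp only [h, het, mul_zero, exp_zero, one_mul] at hle h0
  have hkey : exp (a * t) * y t ≤ y 0 + M / (a - δ) * exp (a * t) := by linarith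
  have hinv : exp (-a * t) * exp (a * t) = 1 := by rw [← exp_add]; simp
  calc y t = exp (-a * t) * (exp (a * t) * y t) := by rw [← mul_assoc, hinv, one_mul]
    _ ≤ exp (-a * t) * (y 0 + M / (a - δ) * exp (a * t)) := by gcongr
    _ = exp (-a * t) * y 0 + M / (a - δ) * (exp (-a * t) * exp (a * t)) := by ring
    _ = exp (-a * t) * y 0 + 1 / (a - δ) * M := by rw [hinv]; ring

/-- Estimate (5.46)/(5.47)-type bound for the scalar ODE `ξ' = -ω² ξ + K(t)` with
`|K(t)| ≤ g(t)`. -/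
theorem stmt14 (ω δ : ℝ) (hω : 0 < ω) (hδ0 : 0 < δ) (hδ : δ < ω ^ 2)
    (ξ K g : ℝ → ℝ)
    (hξ : ContinuousOn ξ (Set.Ici (0:ℝ)))
    (hK : ContinuousOn K (Set.Ici (0:ℝ)))
    (hg : ContinuousOn g (Set.Ici (0:ℝ)))
    (hgnn : ∀ t ≥ (0:ℝ), 0 ≤ g t)
    (hode : ∀ t > (0:ℝ), HasDerivAt ξ (-ω ^ 2 * ξ t + K t) t)
    (hbound : ∀ t ≥ (0:ℝ), |K t| ≤ g t) :
    ∀ t ≥ (0:ℝ), |ξ t| ≤ Real.exp (-ω ^ 2 * t) * |ξ 0| +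
      (1 / (ω ^ 2 - δ)) * ⨆ s ∈ Set.Icc (0:ℝ) t, g s * Real.exp (-δ * (t - s)) := by
  intro t ht
  set M := ⨆ s ∈ Set.Icc (0:ℝ) t, g s * Real.exp (-δ * (t - s)) with hMdef
  have hsup : ∀ s ∈ Set.Icc (0:ℝ) t, g s * exp (-δ * (t - s)) ≤ M := by
    intro s hs
    have hg' : ContinuousOn g (Set.Icc 0 t) := hg.mono Set.Icc_subset_Ici_self
    exact le_biSup_of_continuousOn_of_nonneg (f := fun s => g s * exp (-δ * (t - s)))
      isCompact_Icc (by fun_prop)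
      (fun x hx => mul_nonneg (hgnn x hx.1) (exp_pos _).le) hs
  have hM : 0 ≤ M := (mul_nonneg (hgnn 0 le_rfl) (exp_pos _).le).trans
    (hsup 0 (Set.left_mem_Icc.2 ht))
  have hKM : ∀ s ∈ Set.Icc (0:ℝ) t, |K s| ≤ M * exp (δ * (t - s)) := by
    intro s hs
    have hinv : exp (-δ * (t - s)) * exp (δ * (t - s)) = 1 := by rw [← exp_add]; simp
    calc |K s| ≤ g s := hbound s hs.1
      _ = g s * exp (-δ * (t - s)) * exp (δ * (t - s)) := by rw [mul_assoc, hinv, mul_one]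
      _ ≤ M * exp (δ * (t - s)) := by gcongr; exact hsup s hs
  have hpos := le_of_hasDerivAt_of_le_exp hδ hM ht hξ hode
    fun s hs => (le_abs_self _).trans (hKM s hs)
  have hneg := le_of_hasDerivAt_of_le_exp (y := fun s => -ξ s) (k := fun s => -K s)
    hδ hM ht hξ.neg
    (fun s hs => (hode s hs).neg.congr_deriv (by ring))
    fun s hs => (neg_le_abs _).trans (hKM s hs)
  have h1 := mul_le_mul_of_nonneg_left (le_abs_self (ξ 0)) (exp_pos (-ω ^ 2 * t)).le
  have h2 := mul_le_mul_of_nonneg_left (neg_le_abs (ξ 0)) (exp_pos (-ω ^ 2 * t)).le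
  exact abs_le'.2 ⟨by linarith, by linarith⟩
end

section
/- For every ω ∈ (0,4) and every λ ∈ (0,1), the series Σ_{n=2}^∞ n²/((n² − ω)(n² − ω − λ(4 − ω))) converges and satisfies Σ_{n=2}^∞ n²/((n² − ω)(n² − ω − λ(4 − ω))) ≤ 8(π² − 6)/(3(4 − ω)²(1 − λ)). -/
open Real

theorem hasSum_one_div_add_two_sq :
    HasSum (fun k : ℕ => 1 / ((k : ℝ) + 2) ^ 2) (π ^ 2 / 6 - 1) := by
  have h := (hasSum_nat_add_iff' 2).mpr hasSum_zeta_two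
  simpa [Finset.sum_range_succ] using h

theorem term_le (ω lam x : ℝ) (hω : ω ∈ Set.Ioo (0:ℝ) 4) (hlam : lam ∈ Set.Ioo (0:ℝ) 1)
    (hx : 2 ≤ x) :
    0 ≤ x ^ 2 / ((x ^ 2 - ω) * (x ^ 2 - ω - lam * (4 - ω))) ∧
      x ^ 2 / ((x ^ 2 - ω) * (x ^ 2 - ω - lam * (4 - ω))) ≤
        16 / ((4 - ω) ^ 2 * (1 - lam)) * (1 / x ^ 2) := by
  obtain ⟨hω0, hω4⟩ := hω
  obtain ⟨hl0, hl1⟩ := hlam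
  have hx4 : 4 ≤ x ^ 2 := by nlinarith
  have hω' : 0 < 4 - ω := by linarith
  have hl' : 0 < 1 - lam := by linarith
  have hx0 : 0 < x ^ 2 := by linarith
  have h₁ : x ^ 2 * (4 - ω) / 4 ≤ x ^ 2 - ω := by nlinarith
  have h₂ : (1 - lam) * (x ^ 2 * (4 - ω) / 4) ≤ x ^ 2 - ω - lam * (4 - ω) := by
    nlinarith [mul_le_mul_of_nonneg_left h₁ hl'.le]
  have hA : 0 < x ^ 2 * (4 - ω) / 4 := by positivity
  have hB : 0 < (1 - lam) * (x ^ 2 * (4 - ω) / 4) := by positivity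
  have hC : 0 < x ^ 2 - ω := hA.trans_le h₁
  have hD : 0 < x ^ 2 - ω - lam * (4 - ω) := hB.trans_le h₂
  refine ⟨by positivity, ?_⟩
  calc x ^ 2 / ((x ^ 2 - ω) * (x ^ 2 - ω - lam * (4 - ω)))
      ≤ x ^ 2 / ((x ^ 2 * (4 - ω) / 4) * ((1 - lam) * (x ^ 2 * (4 - ω) / 4))) := by gcongr
    _ = 16 / ((4 - ω) ^ 2 * (1 - lam)) * (1 / x ^ 2) := by
      have hxne : x ≠ 0 := by linarith
      field_simp
      norm_num

/-- Convergence and bound for the series `Σ_{n≥2} n²/((n²-ω)(n²-ω-λ(4-ω)))`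
(here indexed as `n = k + 2`, `k : ℕ`). -/
theorem stmt16 (ω lam : ℝ) (hω : ω ∈ Set.Ioo (0:ℝ) 4) (hlam : lam ∈ Set.Ioo (0:ℝ) 1) :
    Summable (fun k : ℕ => ((k : ℝ) + 2) ^ 2 /
        ((((k : ℝ) + 2) ^ 2 - ω) * (((k : ℝ) + 2) ^ 2 - ω - lam * (4 - ω)))) ∧
      (∑' k : ℕ, ((k : ℝ) + 2) ^ 2 /
        ((((k : ℝ) + 2) ^ 2 - ω) * (((k : ℝ) + 2) ^ 2 - ω - lam * (4 - ω)))) ≤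
        8 * (π ^ 2 - 6) / (3 * (4 - ω) ^ 2 * (1 - lam)) := by
  have hbound := fun k : ℕ =>
    term_le ω lam ((k : ℝ) + 2) hω hlam (le_add_of_nonneg_left k.cast_nonneg)
  have hsum := hasSum_one_div_add_two_sq.mul_left (16 / ((4 - ω) ^ 2 * (1 - lam)))
  have hs := Summable.of_nonneg_of_le (fun k => (hbound k).1) (fun k => (hbound k).2) hsum.summable
  refine ⟨hs, (hasSum_le (fun k => (hbound k).2) hs.hasSum hsum).trans_eq ?_⟩
  have hω' : 4 - ω ≠ 0 := (sub_pos.mpr hω.2).ne'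
  have hl' : 1 - lam ≠ 0 := (sub_pos.mpr hlam.2).ne'
  field_simp
  ring
end
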